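/- Let β be a blanket for Adv(r) and let λ ∈ Neg(β). Then for each extended literal e ∈ β, the set λ contains exactly one extended literal e' such that e and e' are complementary. -/

import Mathlib

/-! ## Classical and extended literals -/

/-- A classical literal over atoms `A`: an atom `a` (positive) or a strongly
negated atom `¬a` (negative). -/
inductive CLit (A : Type) : Type
  | pos : A → CLit A
  | neg : A → CLit A
deriving DecidableEq

namespace CLit

/-- The strong complement of a classical literal. -/
def compl {A : Type} : CLit A → CLit A
  | pos a => neg a
  | neg a => pos a

/-- The underlying atom of a classical literal. -/
def atom {A : Type} : CLit A → A
  | pos a => a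
  | neg a => a

end CLit

/-- Two classical literals are strongly complementary. -/
def StronglyComp {A : Type} (L L' : CLit A) : Prop := L' = L.compl

/-- A set of classical literals is consistent iff it contains no strongly
complementary pair. -/
def Consistent {A : Type} (S : Set (CLit A)) : Prop := ∀ L ∈ S, L.compl ∉ S

/-- An extended literal: a classical literal `L` or a default-negated
classical literal `not L`. -/
inductive ELit (A : Type) : Type
  | lit : CLit A → ELit A
  | not : CLit A → ELit A
deriving DecidableEq

namespace ELit

/-- The underlying atom of an extended literal. -/
def atom {A : Type} : ELit A → A
  | lit L => L.atom
  | not L => L.atom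

end ELit

/-- Two extended literals are atom-related iff they have the same underlying atom. -/
def AtomRelated {A : Type} (e e' : ELit A) : Prop := e.atom = e'.atom

/-- Strongly complementary extended literals: `L` and its strong complement. -/
def EStrComp {A : Type} (e e' : ELit A) : Prop :=
  ∃ L : CLit A, e = ELit.lit L ∧ e' = ELit.lit L.compl

/-- Default complementary extended literals: `L` and `not L`. -/
def EDefComp {A : Type} (e e' : ELit A) : Prop :=
  ∃ L : CLit A, (e = ELit.lit L ∧ e' = ELit.not L) ∨ (e = ELit.not L ∧ e' = ELit.lit L)

/-- Complementary extended literals: strongly or default complementary. -/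
def EComp {A : Type} (e e' : ELit A) : Prop := EStrComp e e' ∨ EDefComp e e'

/-- Dual extended literals: `L` and `not (strong complement of L)`. -/
def EDual {A : Type} (e e' : ELit A) : Prop :=
  ∃ L : CLit A, (e = ELit.lit L ∧ e' = ELit.not L.compl) ∨ (e = ELit.not L.compl ∧ e' = ELit.lit L)

/-- Reconcilable extended literals: `not L` and `not (strong complement of L)`. -/
def EReconc {A : Type} (e e' : ELit A) : Prop :=
  ∃ L : CLit A, e = ELit.not L ∧ e' = ELit.not L.compl

/-- Satisfaction of an extended literal by a set of classical literals:
`S ⊨ L` iff `L ∈ S`, and `S ⊨ not L` iff `L ∉ S`. -/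
def SatE {A : Type} (S : Set (CLit A)) : ELit A → Prop
  | ELit.lit L => L ∈ S
  | ELit.not L => L ∉ S

/-- A set `S` of classical literals satisfies a set `X` of extended literals
iff it satisfies every element of `X`. -/
def SatAll {A : Type} (S : Set (CLit A)) (X : Set (ELit A)) : Prop := ∀ e ∈ X, SatE S e

/-! ## Rules and programs -/

/-- A rule: a head (a classical literal) and a finite body of extended literals. -/
structure Rule (A : Type) where
  head : CLit A
  body : Finset (ELit A)

/-- The classical literals occurring positively in the body, `B⁺(r)`. -/
def Rule.bodyPos {A : Type} (r : Rule A) : Set (CLit A) := {L | ELit.lit L ∈ r.body}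

/-- The classical literals occurring default-negated in the body, `B⁻(r)`. -/
def Rule.bodyNeg {A : Type} (r : Rule A) : Set (CLit A) := {L | ELit.not L ∈ r.body}

/-- A rule is applicable iff some consistent set of classical literals
satisfies its body. -/
def Applicable {A : Type} (r : Rule A) : Prop :=
  ∃ S : Set (CLit A), Consistent S ∧ SatAll S ↑r.body

/-- Two rules `r ≠ r'` are conflicting iff their heads are strongly complementary
and some consistent set of classical literals satisfies both bodies. -/
def Conflicting {A : Type} (r r' : Rule A) : Prop :=
  r ≠ r' ∧ StronglyComp r.head r'.head ∧
    ∃ S : Set (CLit A), Consistent S ∧ SatAll S ↑r.body ∧ SatAll S ↑r'.body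

/-! ## Answer set semantics -/

/-- `S` is a model of the positive parts: for each rule, the head is in `S`
whenever the positive body is contained in `S`. -/
def PModel {A : Type} (P : Set (Rule A)) (S : Set (CLit A)) : Prop :=
  ∀ r ∈ P, r.bodyPos ⊆ S → r.head ∈ S

/-- The least model of a program without default negation. -/
def leastModel {A : Type} (P : Set (Rule A)) : Set (CLit A) := ⋂₀ {S | PModel P S}

open Classical in
/-- The answer set of a program without default negation: the least model if it
is consistent, and the set `Lit_A` of all classical literals otherwise. -/
noncomputable def posAnswerSet {A : Type} (P : Set (Rule A)) : Set (CLit A) :=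
  if Consistent (leastModel P) then leastModel P else Set.univ

/-- Whether an extended literal is a (positive occurrence of a) classical literal. -/
def ELit.isPos {A : Type} : ELit A → Bool
  | ELit.lit _ => true
  | ELit.not _ => false

/-- The reduct `P^S`: keep the rules with `B⁻(r) ∩ S = ∅`, as `H(r) ← B⁺(r)`. -/
def reduct {A : Type} (P : Set (Rule A)) (S : Set (CLit A)) : Set (Rule A) :=
  {r' | ∃ r ∈ P, r.bodyNeg ∩ S = ∅ ∧ r' = ⟨r.head, r.body.filter (fun e => e.isPos)⟩}

/-- `S` is an answer set of `P` iff `S` is the answer set of the reduct `P^S`. -/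
def AnswerSet {A : Type} (P : Set (Rule A)) (S : Set (CLit A)) : Prop :=
  S = posAnswerSet (reduct P S)

/-- The fact corresponding to a classical literal: a rule with empty body. -/
def fact {A : Type} (L : CLit A) : Rule A := ⟨L, ∅⟩

/-! ## Blankets and the negation operator -/

/-- The adversarial rules of `r` in the program `P`. -/
def Adv {A : Type} (P : Set (Rule A)) (r : Rule A) : Set (Rule A) :=
  {r' ∈ P | Conflicting r r'}

/-- The negation operator on extended literals:
`neg a = {not a, ¬a}`, `neg ¬a = {not ¬a, a}`, `neg (not a) = {a}`, `neg (not ¬a) = {¬a}`. -/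
def negE {A : Type} : ELit A → Set (ELit A)
  | ELit.lit L => {ELit.not L, ELit.lit L.compl}
  | ELit.not L => {ELit.lit L}

/-- `neg(e, X) = ⋂ {neg k : k ∈ X, k atom-related to e}`. -/
def negDep {A : Type} (e : ELit A) (X : Set (ELit A)) : Set (ELit A) :=
  ⋂ k ∈ {k ∈ X | AtomRelated k e}, negE k

/-- `Neg(X)`: all sets `T` of extended literals containing exactly one element of
each nonempty set `neg(e, X)` for `e ∈ X`, and nothing else. -/
def NegSets {A : Type} (X : Set (ELit A)) : Set (Set (ELit A)) :=
  {T | (∀ e ∈ X, (negDep e X).Nonempty → ∃! t, t ∈ T ∧ t ∈ negDep e X) ∧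
       (∀ t ∈ T, ∃ e ∈ X, t ∈ negDep e X)}

/-- All blanket conditions except `⊆`-minimality: nonempty, no complementary pair,
no reconcilable pair, atoms disjoint from the atoms of `B(r)`, and meeting the body
of every adversarial rule of `r`. -/
def PreBlanket {A : Type} (P : Set (Rule A)) (r : Rule A) (β : Set (ELit A)) : Prop :=
  β.Nonempty ∧
  (∀ e ∈ β, ∀ e' ∈ β, ¬ EComp e e') ∧
  (∀ e ∈ β, ∀ e' ∈ β, ¬ EReconc e e') ∧
  (∀ e ∈ β, ∀ e' ∈ r.body, e.atom ≠ ELit.atom e') ∧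
  (∀ rj ∈ Adv P r, ∃ e ∈ β, e ∈ rj.body)

/-- A blanket for `Adv(r)` (with ambient program `P`): a `⊆`-minimal set
satisfying the blanket conditions. -/
def Blanket {A : Type} (P : Set (Rule A)) (r : Rule A) (β : Set (ELit A)) : Prop :=
  PreBlanket P r β ∧ ∀ β' ⊆ β, PreBlanket P r β' → β' = β

theorem mem_negE_iff_eComp {A : Type} (e e' : ELit A) : e' ∈ negE e ↔ EComp e e' := by
  rcases e with L | L <;> simp [negE, EComp, EStrComp, EDefComp, or_comm]

theorem AtomRelated.of_mem_negE {A : Type} {e t : ELit A} (h : t ∈ negE e) :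
    AtomRelated t e := by
  rcases e with (a | a) | (a | a) <;>
    simp only [negE, Set.mem_insert_iff, Set.mem_singleton_iff] at h
  all_goals first
    | subst h; rfl
    | rcases h with rfl | rfl <;> rfl

theorem mem_negDep_iff {A : Type} {e t : ELit A} {X : Set (ELit A)} :
    t ∈ negDep e X ↔ ∀ k ∈ X, AtomRelated k e → t ∈ negE k := by
  simp [negDep]

theorem negDep_congr {A : Type} {e e' : ELit A} (X : Set (ELit A)) (h : AtomRelated e e') :
    negDep e X = negDep e' X := by
  have h' : e.atom = e'.atom := h
  simp only [negDep, AtomRelated, h']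

theorem CLit.eq_or_eq_compl {A : Type} {L M : CLit A} (h : M.atom = L.atom) :
    M = L ∨ M = L.compl := by
  rcases L with a | a <;> rcases M with b | b <;> simp_all [CLit.atom, CLit.compl]

theorem CLit.compl_compl {A : Type} (L : CLit A) : L.compl.compl = L := by
  cases L <;> rfl

/-- The negation sets of atom-related elements have a common member as soon as there is no
complementary and no reconcilable pair. -/
theorem negDep_nonempty {A : Type} {X : Set (ELit A)}
    (hcomp : ∀ e ∈ X, ∀ e' ∈ X, ¬ EComp e e') (hrec : ∀ e ∈ X, ∀ e' ∈ X, ¬ EReconc e e')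
    {e : ELit A} (he : e ∈ X) : (negDep e X).Nonempty := by
  rcases e with L | L
  · refine ⟨ELit.lit L.compl, mem_negDep_iff.2 fun k hk hrel => ?_⟩
    rcases k with M | M <;> rcases CLit.eq_or_eq_compl (show M.atom = L.atom from hrel) with rfl | rfl
    · exact Or.inr rfl
    · exact absurd (Or.inl ⟨L, rfl, rfl⟩) (hcomp _ he _ hk)
    · exact absurd (Or.inr ⟨M, Or.inl ⟨rfl, rfl⟩⟩) (hcomp _ he _ hk)
    · rfl
  · refine ⟨ELit.lit L, mem_negDep_iff.2 fun k hk hrel => ?_⟩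
    rcases k with M | M <;> rcases CLit.eq_or_eq_compl (show M.atom = L.atom from hrel) with rfl | rfl
    · exact absurd (Or.inr ⟨M, Or.inr ⟨rfl, rfl⟩⟩) (hcomp _ he _ hk)
    · exact Or.inr (by rw [CLit.compl_compl]; rfl)
    · rfl
    · exact absurd ⟨L, rfl, rfl⟩ (hrec _ he _ hk)

/-- For a blanket `β` for `Adv(r)` and `λ ∈ Neg(β)`: for each
`e ∈ β`, `λ` contains exactly one extended literal complementary to `e`. -/
theorem stmt_7 {A : Type} (P : Set (Rule A)) (r : Rule A)
    (β : Set (ELit A)) (hβ : Blanket P r β)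
    (lam : Set (ELit A)) (hlam : lam ∈ NegSets β) :
    ∀ e ∈ β, ∃! e', e' ∈ lam ∧ EComp e e' := by
  intro e he
  obtain ⟨⟨-, hcomp, hrec, -, -⟩, -⟩ := hβ
  obtain ⟨hone, honly⟩ := hlam
  obtain ⟨t, ⟨htlam, ht⟩, huniq⟩ := hone e he (negDep_nonempty hcomp hrec he)
  refine ⟨t, ⟨htlam, (mem_negE_iff_eComp e t).1 (mem_negDep_iff.1 ht e he rfl)⟩, ?_⟩
  rintro u ⟨hulam, hu⟩
  obtain ⟨k, hk, huk⟩ := honly u hulam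
  have hue : AtomRelated u e := .of_mem_negE ((mem_negE_iff_eComp e u).2 hu)
  have huk' : AtomRelated u k := .of_mem_negE (mem_negDep_iff.1 huk k hk rfl)
  have hke : AtomRelated k e := huk'.symm.trans hue
  exact huniq u ⟨hulam, negDep_congr β hke ▸ huk⟩
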